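/- Let G be a finitely generated group with no nontrivial locally finite normal subgroup, and let K_G be the set of elements of G that centralize some finite-index normal subgroup of G. Then K_G is a torsion-free abelian normal subgroup of G. -/

import Mathlib

/-- The set of elements of `G` centralizing some finite-index normal subgroup of `G`;
this is the kernel of the natural map from `G` to its abstract commensurator. -/
def KSet (G : Type*) [Group G] : Set G :=
  {g : G | ∃ H : Subgroup G, H.Normal ∧ H.FiniteIndex ∧ ∀ h ∈ H, Commute g h}

/-- A group is locally finite if every finitely generated subgroup is finite. -/
def LocallyFiniteGroup (G : Type*) [Group G] : Prop :=
  ∀ s : Finset G, Finite (Subgroup.closure (s : Set G))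

/-- A group is locally nilpotent if every finitely generated subgroup is nilpotent. -/
def LocallyNilpotentGroup (G : Type*) [Group G] : Prop :=
  ∀ s : Finset G, Group.IsNilpotent (Subgroup.closure (s : Set G))

open Subgroup in
/-- A variant of Schur's theorem: a central-by-finite group has finite derived subgroup. -/
theorem finite_commutator_of_finiteIndex_center (P : Type*) [Group P] [(center P).FiniteIndex] :
    Finite (_root_.commutator P) := by
  have hfin : Finite (commutatorSet P) := by
    let r : P ⧸ center P → P := Quotient.out
    have hr (a : P) : ∃ z ∈ center P, a = r a * z :=
      ⟨(r a)⁻¹ * a, QuotientGroup.eq.mp (QuotientGroup.out_eq' (a : P ⧸ center P)), by group⟩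
    refine (Set.finite_range fun p : (P ⧸ center P) × (P ⧸ center P) ↦
      r p.1 * r p.2 * (r p.1)⁻¹ * (r p.2)⁻¹).subset ?_
    rintro _ ⟨a, b, rfl⟩
    refine ⟨(a, b), ?_⟩
    obtain ⟨y, hy, hay⟩ := hr a
    obtain ⟨z, hz, hbz⟩ := hr b
    have hyc := mem_center_iff.mp hy
    have hzc := mem_center_iff.mp hz
    change r a * r b * (r a)⁻¹ * (r b)⁻¹ = a * b * a⁻¹ * b⁻¹
    generalize r a = u at *
    generalize r b = v at *
    subst hay hbz
    have hz' : z * u⁻¹ = u⁻¹ * z := (hzc _).symm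
    simp only [mul_inv_rev]
    rw [show u * y * (v * z) = u * v * z * y by rw [mul_assoc u, ← hyc]; group]
    rw [show u * v * z * y * (y⁻¹ * u⁻¹) = u * v * (z * u⁻¹) by group, hz']
    group
  infer_instance

open Subgroup in
/-- The centralizer of a finite-index subgroup has finite derived subgroup. -/
theorem finite_commutator_centralizer {G : Type*} [Group G] (H : Subgroup G) [H.FiniteIndex] :
    Finite (⁅centralizer (H : Set G), centralizer (H : Set G)⁆ : Subgroup G) := by
  have hle : H.subgroupOf (centralizer H) ≤ center (centralizer (H : Set G)) := by
    intro x hx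
    refine mem_center_iff.mpr fun g ↦ Subtype.ext ?_
    exact (mem_centralizer_iff.mp g.2 x hx).symm
  have := finiteIndex_of_le hle
  have := finite_commutator_of_finiteIndex_center (centralizer (H : Set G))
  rw [← map_subtype_commutator]
  exact Set.Finite.image _ this

/-- If every finite subset of a subgroup lies in a finite subgroup, the subgroup is locally
finite. -/
theorem locallyFiniteGroup_of_exists_finite_subgroup {G : Type*} [Group G] (N : Subgroup G)
    (h : ∀ s : Finset N, ∃ F : Subgroup G, Finite F ∧ ∀ x ∈ s, (x : G) ∈ F) :
    LocallyFiniteGroup N := by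
  intro s
  obtain ⟨F, hF, hs⟩ := h s
  have hle : Subgroup.closure (s : Set N) ≤ F.comap N.subtype := (Subgroup.closure_le _).mpr hs
  exact Set.Finite.subset (Set.Finite.preimage N.subtype_injective.injOn (Set.toFinite (F : Set G)))
    hle

/-- A commutative torsion group is locally finite. -/
theorem locallyFiniteGroup_of_isOfFinOrder {N : Type*} [Group N] (hcomm : ∀ x y : N, Commute x y)
    (htor : ∀ x : N, IsOfFinOrder x) : LocallyFiniteGroup N := by
  intro s
  let _ : CommGroup (Subgroup.closure (s : Set N)) :=
    { (inferInstance : Group (Subgroup.closure (s : Set N))) with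
      mul_comm := fun x y ↦ Subtype.ext (hcomm x y) }
  have : Group.FG (Subgroup.closure (s : Set N)) := Group.closure_finset_fg s
  exact CommGroup.finite_of_fg_isMulTorsion _ fun x ↦ Submonoid.isOfFinOrder_coe.mp (htor x)

/-- The subgroup of elements centralizing some finite-index normal subgroup. -/
def KSubgroup (G : Type*) [Group G] : Subgroup G where
  carrier := KSet G
  one_mem' := ⟨⊤, inferInstance, inferInstance, fun h _ ↦ Commute.one_left h⟩
  mul_mem' := by
    rintro a b ⟨H, _, _, ha⟩ ⟨L, _, _, hb⟩
    exact ⟨H ⊓ L, inferInstance, inferInstance, fun h hh ↦ (ha h hh.1).mul_left (hb h hh.2)⟩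
  inv_mem' := by
    rintro a ⟨H, hn, hi, ha⟩
    exact ⟨H, hn, hi, fun h hh ↦ (ha h hh).inv_left⟩

instance KSubgroup_normal (G : Type*) [Group G] : (KSubgroup G).Normal where
  conj_mem := by
    rintro a ⟨H, hn, hi, ha⟩ g
    refine ⟨H, hn, hi, fun h hh ↦ ?_⟩
    have h1 := (ha _ (hn.conj_mem h hh g⁻¹)).conj g
    simpa [mul_assoc] using h1

open Subgroup in
/-- Every element of the derived subgroup of `KSubgroup G` lies in the derived subgroup of the
centralizer of some finite-index subgroup. -/
theorem exists_mem_commutator_centralizer {G : Type*} [Group G] {x : G}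
    (hx : x ∈ ⁅KSubgroup G, KSubgroup G⁆) :
    ∃ H : Subgroup G, H.FiniteIndex ∧ x ∈ ⁅centralizer (H : Set G), centralizer (H : Set G)⁆ := by
  have mono {H L : Subgroup G} (h : H ≤ L) : ⁅centralizer (L : Set G), centralizer (L : Set G)⁆ ≤
      ⁅centralizer (H : Set G), centralizer (H : Set G)⁆ :=
    commutator_mono (centralizer_le h) (centralizer_le h)
  refine closure_induction ?_ ⟨⊤, inferInstance, one_mem _⟩ ?_ ?_ hx
  · rintro _ ⟨a, ⟨H, _, _, ha⟩, b, ⟨L, _, _, hb⟩, rfl⟩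
    refine ⟨H ⊓ L, inferInstance, commutator_mem_commutator ?_ ?_⟩
    · exact mem_centralizer_iff.mpr fun h hh ↦ (ha h hh.1).symm
    · exact mem_centralizer_iff.mpr fun h hh ↦ (hb h hh.2).symm
  · rintro a b _ _ ⟨H, _, ha⟩ ⟨L, _, hb⟩
    exact ⟨H ⊓ L, inferInstance, mul_mem (mono inf_le_left ha) (mono inf_le_right hb)⟩
  · rintro a _ ⟨H, hi, ha⟩
    exact ⟨H, hi, inv_mem ha⟩

open Subgroup in
/-- The derived subgroup of `KSubgroup G` is locally finite. -/
theorem locallyFiniteGroup_commutator_KSubgroup (G : Type*) [Group G] :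
    LocallyFiniteGroup (⁅KSubgroup G, KSubgroup G⁆ : Subgroup G) := by
  refine locallyFiniteGroup_of_exists_finite_subgroup _ fun s ↦ ?_
  choose H hH hmem using fun x : (⁅KSubgroup G, KSubgroup G⁆ : Subgroup G) ↦
    exists_mem_commutator_centralizer x.2
  have : (⨅ x : s, H x).FiniteIndex := finiteIndex_iInf fun x ↦ hH x
  refine ⟨_, finite_commutator_centralizer (⨅ x : s, H x), fun x hx ↦ ?_⟩
  have hle : ⨅ x : s, H x ≤ H x := iInf_le (fun x : s ↦ H x) ⟨x, hx⟩
  exact commutator_mono (centralizer_le hle) (centralizer_le hle) (hmem x)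

/-- If a finitely generated group `G` has no nontrivial locally finite normal subgroup,
then `K_G`, the set of elements of `G` centralizing some finite-index normal subgroup,
is a torsion-free abelian normal subgroup of `G`. -/
theorem KG_torsion_free_abelian (G : Type*) [Group G] (hfg : Group.FG G)
    (hnolf : ∀ N : Subgroup G, N.Normal → LocallyFiniteGroup N → N = ⊥) :
    ∃ K : Subgroup G, (K : Set G) = KSet G ∧ K.Normal ∧
      (∀ x ∈ K, ∀ y ∈ K, Commute x y) ∧
      (∀ x ∈ K, x ≠ 1 → ¬IsOfFinOrder x) := by
  have hcomm : ∀ x ∈ KSubgroup G, ∀ y ∈ KSubgroup G, Commute x y := fun x hx y hy ↦ by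
    have hbot := hnolf _ inferInstance (locallyFiniteGroup_commutator_KSubgroup G)
    have hxy := Subgroup.commutator_mem_commutator hx hy
    rwa [hbot, Subgroup.mem_bot, commutatorElement_eq_one_iff_commute] at hxy
  refine ⟨KSubgroup G, rfl, inferInstance, hcomm, fun x hx hne hfin ↦ hne ?_⟩
  let T : Subgroup G :=
    { carrier := {x | x ∈ KSubgroup G ∧ IsOfFinOrder x}
      one_mem' := ⟨one_mem _, IsOfFinOrder.one⟩
      mul_mem' := fun ha hb ↦
        ⟨mul_mem ha.1 hb.1, (hcomm _ ha.1 _ hb.1).isOfFinOrder_mul ha.2 hb.2⟩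
      inv_mem' := fun ha ↦ ⟨inv_mem ha.1, ha.2.inv⟩ }
  have hT : T.Normal :=
    ⟨fun a ha g ↦ ⟨(KSubgroup_normal G).conj_mem a ha.1 g,
      (MulAut.conj g).toMonoidHom.isOfFinOrder ha.2⟩⟩
  have hbot : T = ⊥ := hnolf T hT <| locallyFiniteGroup_of_isOfFinOrder
    (fun a b ↦ Subtype.ext (hcomm a a.2.1 b b.2.1))
    fun a ↦ Submonoid.isOfFinOrder_coe.mp a.2.2
  have hxT : x ∈ T := ⟨hx, hfin⟩
  rwa [hbot, Subgroup.mem_bot] at hxT
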